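/- Fix τ with 0 < τ < 1. Then as N → ∞ over positive integers, 2τ − τ·( ψ(N(τ + 1/2) + 1/2) − ψ((N+1)/2) ) = 2τ − τ·log(1 + 2τ) + (τ/(6N²))·(1 − 1/(1 + 2τ)²) + O(N⁻⁴); that is, there exist C > 0 and N₀ such that for all N ≥ N₀ the difference between the left-hand side and 2τ − τ·log(1+2τ) + (τ/(6N²))·(1 − 1/(1+2τ)²) is at most C·N⁻⁴ in absolute value. -/

import Mathlib

open Real

/-- The digamma function `ψ(x) = Γ'(x)/Γ(x)` on the reals. -/
noncomputable def digamma (x : ℝ) : ℝ := deriv Real.Gamma x / Real.Gamma x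

open Filter Topology Set

lemma dg_log_bounds {x : ℝ} (hx : 0 < x) :
    Real.log x ≤ digamma (x + 1) ∧ digamma x ≤ Real.log x ∧
      digamma (x + 1) = digamma x + 1 / x := by
  let f := Real.log ∘ Real.Gamma
  have hc : ConvexOn ℝ (Ioi 0) f := Real.convexOn_log_Gamma
  have h_rec (x : ℝ) (hx : 0 < x) : f (x + 1) = f x + Real.log x := by
    simp only [f, Function.comp_apply, Real.Gamma_add_one hx.ne',
      Real.log_mul hx.ne' (Real.Gamma_pos_of_pos hx).ne', add_comm]
  have hdG {x : ℝ} (hx : 0 < x) : DifferentiableAt ℝ Real.Gamma x :=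
    Real.differentiableAt_Gamma (fun m ↦ ne_of_gt (by
      have : (0 : ℝ) ≤ m := m.cast_nonneg
      linarith))
  have hder {x : ℝ} (hx : 0 < x) : DifferentiableAt ℝ f x :=
    (hdG hx).log (Real.Gamma_pos_of_pos hx).ne'
  have hdg {x : ℝ} (hx : 0 < x) : deriv f x = digamma x := by
    simp only [f, Function.comp_def, digamma]
    rw [deriv.log (hdG hx) (Real.Gamma_pos_of_pos hx).ne']
  have hder_rec (x : ℝ) (hx : 0 < x) : deriv f (x + 1) = deriv f x + 1 / x := by
    rw [← deriv_comp_add_const, one_div, ← Real.deriv_log,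
      ← deriv_add (hder <| by positivity) (Real.differentiableAt_log hx.ne')]
    apply EventuallyEq.deriv_eq
    filter_upwards [eventually_gt_nhds hx] using h_rec
  have hx1 : 0 < x + 1 := by linarith
  have hs : slope f x (x + 1) = Real.log x := by
    rw [slope_def_field, h_rec x hx]; simp
  refine ⟨?_, ?_, ?_⟩
  · rw [← hdg hx1, ← hs]
    exact hc.slope_le_deriv hx hx1 (by linarith) (hder hx1)
  · rw [← hdg hx, ← hs]
    exact hc.deriv_le_slope hx hx1 (by linarith) (hder hx)
  · rw [← hdg hx, ← hdg hx1]; exact hder_rec x hx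

lemma nonneg_of_deriv_nonpos {f f' : ℝ → ℝ} (hd : ∀ x, 0 < x → HasDerivAt f (f' x) x)
    (hf' : ∀ x, 0 < x → f' x ≤ 0) (hl : Tendsto f atTop (𝓝 0)) {x : ℝ} (hx : 0 < x) :
    0 ≤ f x := by
  have ha : AntitoneOn f (Ioi 0) := by
    apply antitoneOn_of_deriv_nonpos (convex_Ioi 0)
    · exact fun y hy => (hd y hy).continuousAt.continuousWithinAt
    · rw [interior_Ioi]
      exact fun y hy => (hd y hy).differentiableAt.differentiableWithinAt
    · rw [interior_Ioi]
      intro y hy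
      rw [(hd y hy).deriv]
      exact hf' y hy
  apply le_of_tendsto hl
  filter_upwards [eventually_ge_atTop x] with y hy
  exact ha hx (lt_of_lt_of_le hx hy) hy

/-- `g x - g (x+1)` for `g x = ψ (x+1/2) - log x - 1/(24 x²)`. -/
noncomputable def dgH (x : ℝ) : ℝ :=
  Real.log (x + 1) - Real.log x - (x + 1 / 2)⁻¹ - (1 / 24) * ((x ^ 2)⁻¹ - ((x + 1) ^ 2)⁻¹)

lemma tendsto_pow_inv (a : ℝ) (n : ℕ) (hn : n ≠ 0) :
    Tendsto (fun x : ℝ => ((x + a) ^ n)⁻¹) atTop (𝓝 0) :=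
  tendsto_inv_atTop_zero.comp
    ((tendsto_pow_atTop hn).comp (tendsto_atTop_add_const_right _ a tendsto_id))

lemma dgH_tendsto : Tendsto dgH atTop (𝓝 0) := by
  have h1 := Real.tendsto_log_comp_add_sub_log 1
  have h2 := tendsto_pow_inv (1 / 2) 1 one_ne_zero
  have h3 := tendsto_pow_inv 0 2 two_ne_zero
  have h4 := tendsto_pow_inv 1 2 two_ne_zero
  have := (h1.sub h2).sub ((h3.sub h4).const_mul (1 / 24))
  simp only [mul_zero, sub_zero, add_zero, pow_one] at this
  exact this

lemma hasDerivAt_pow_inv (a : ℝ) (n : ℕ) {x : ℝ} (hx : x + a ≠ 0) :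
    HasDerivAt (fun x : ℝ => ((x + a) ^ n)⁻¹) (-(n * (x + a) ^ (n - 1)) / ((x + a) ^ n) ^ 2) x := by
  have := (((hasDerivAt_id x).add_const a).pow n).inv (pow_ne_zero n hx)
  refine HasDerivAt.congr_deriv (f := fun x : ℝ => ((x + a) ^ n)⁻¹) this ?_
  simp

lemma dgH_deriv {x : ℝ} (hx : 0 < x) :
    HasDerivAt dgH ((7 * (x * (x + 1)) + 1) /
      (12 * (x * (x + 1)) ^ 3 * (4 * (x * (x + 1)) + 1))) x := by
  have h0 : x + 1 ≠ 0 := by positivity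
  have h01 : x + 1 / 2 ≠ 0 := by positivity
  have h1 := ((hasDerivAt_id x).add_const 1).log h0
  have h1' := Real.hasDerivAt_log hx.ne'
  have h2 := hasDerivAt_pow_inv (1 / 2) 1 h01
  have h3 := hasDerivAt_pow_inv 0 2 (x := x) (by simpa using hx.ne')
  have h4 := hasDerivAt_pow_inv 1 2 h0
  have h := ((h1.sub h1').sub h2).sub ((h3.sub h4).const_mul (1 / 24))
  have hf : dgH = (((fun x : ℝ => Real.log (id x + 1)) - Real.log) - fun x : ℝ => ((x + 1 / 2) ^ 1)⁻¹)
      - fun x => (1 / 24) * ((fun x : ℝ => ((x + 0) ^ 2)⁻¹) - fun x : ℝ => ((x + 1) ^ 2)⁻¹ : ℝ → ℝ) x := by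
    ext y; simp [dgH]
  rw [hf]
  refine h.congr_deriv ?_
  have h5 : 4 * (x * (x + 1)) + 1 = (2 * x + 1) ^ 2 := by ring
  have h6 : x + 1 / 2 = (2 * x + 1) / 2 := by ring
  have h7 : 2 * x + 1 ≠ 0 := by positivity
  rw [h5, h6]
  simp only [id, add_zero]
  norm_num
  field_simp
  ring

lemma dgH_nonpos {x : ℝ} (hx : 0 < x) : dgH x ≤ 0 := by
  have := nonneg_of_deriv_nonpos (f := -dgH) (fun x hx => (dgH_deriv hx).neg)
    (fun x hx => neg_nonpos.2 (by positivity)) (by rw [← neg_zero]; exact dgH_tendsto.neg) hx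
  simpa using this

lemma dgH_lower {x : ℝ} (hx : 0 < x) : 0 ≤ dgH x + ((x ^ 4)⁻¹ - ((x + 1) ^ 4)⁻¹) := by
  have h3 := tendsto_pow_inv 0 4 four_ne_zero
  have h4 := tendsto_pow_inv 1 4 four_ne_zero
  have hl := dgH_tendsto.add (h3.sub h4)
  have := nonneg_of_deriv_nonpos (x := x)
    (f := dgH + ((fun x : ℝ => ((x + 0) ^ 4)⁻¹) - fun x : ℝ => ((x + 1) ^ 4)⁻¹))
    (f' := fun x => (7 * (x * (x + 1)) + 1) /
      (12 * (x * (x + 1)) ^ 3 * (4 * (x * (x + 1)) + 1)) -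
      4 * (5 * (x * (x + 1)) ^ 2 + 5 * (x * (x + 1)) + 1) / (x * (x + 1)) ^ 5)
    ?_ ?_ (by simpa [Pi.add_def, Pi.sub_def] using hl) hx
  · simpa using this
  · intro x hx
    have h0 : x + 1 ≠ 0 := by positivity
    have h3 := hasDerivAt_pow_inv 0 4 (x := x) (by simpa using hx.ne')
    have h4 := hasDerivAt_pow_inv 1 4 h0
    refine ((dgH_deriv hx).add (h3.sub h4)).congr_deriv ?_
    rw [sub_eq_add_neg _ (4 * _ / _)]
    congr 1
    norm_num
    field_simp
    ring
  · intro x hx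
    have hp : 0 < x * (x + 1) := by positivity
    generalize x * (x + 1) = p at hp
    rw [sub_nonpos, div_le_div_iff₀ (by positivity) (by positivity)]
    have : 0 ≤ p ^ 3 * (48 * (4 * p + 1) * (5 * p ^ 2 + 5 * p + 1) - (7 * p + 1) * p ^ 2) := by
      apply mul_nonneg (by positivity)
      ring_nf
      positivity
    nlinarith [this]

noncomputable def dgG (x : ℝ) : ℝ := digamma (x + 1 / 2) - Real.log x - (1 / 24) * (x ^ 2)⁻¹

lemma dgG_sub {x : ℝ} (hx : 0 < x) : dgG x - dgG (x + 1) = dgH x := by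
  have h := (dg_log_bounds (x := x + 1 / 2) (by positivity)).2.2
  rw [one_div (x + 1 / 2)] at h
  simp only [dgG, dgH]
  rw [show x + 1 + 1 / 2 = x + 1 / 2 + 1 by ring, h]
  ring

lemma dgG_tendsto : Tendsto dgG atTop (𝓝 0) := by
  have h3 := (tendsto_pow_inv 0 2 two_ne_zero).const_mul (1 / 24)
  have hu := (Real.tendsto_log_comp_add_sub_log (1 / 2)).sub h3
  have hl := (Real.tendsto_log_comp_add_sub_log (-1 / 2)).sub h3
  simp only [mul_zero, sub_zero, add_zero] at hu hl
  refine tendsto_of_tendsto_of_tendsto_of_le_of_le' hl hu ?_ ?_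
  · filter_upwards [eventually_gt_atTop 1] with x hx
    have h := (dg_log_bounds (x := x + -1 / 2) (by linarith)).1
    rw [show x + -1 / 2 + 1 = x + 1 / 2 by ring] at h
    simp only [dgG]
    linarith
  · filter_upwards [eventually_gt_atTop 1] with x hx
    have h := (dg_log_bounds (x := x + 1 / 2) (by linarith)).2.1
    simp only [dgG]
    linarith

lemma nonneg_of_step {f : ℝ → ℝ} (hs : ∀ x, 0 < x → f (x + 1) ≤ f x)
    (hl : Tendsto f atTop (𝓝 0)) {x : ℝ} (hx : 0 < x) : 0 ≤ f x := by
  have hn : ∀ n : ℕ, f (x + n) ≤ f x := by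
    intro n
    induction n with
    | zero => simp
    | succ n ih =>
      have := hs (x + n) (by positivity)
      push_cast
      rw [← add_assoc]
      linarith
  exact le_of_tendsto' (hl.comp (tendsto_atTop_add_const_left _ x tendsto_natCast_atTop_atTop)) hn

lemma dgG_bounds {x : ℝ} (hx : 0 < x) : dgG x ≤ 0 ∧ -(x ^ 4)⁻¹ ≤ dgG x := by
  constructor
  · have := nonneg_of_step (f := -dgG) (fun x hx => by
      have h1 := dgG_sub hx
      have h2 := dgH_nonpos hx
      simp only [Pi.neg_apply]
      linarith) (by rw [← neg_zero]; exact dgG_tendsto.neg) hx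
    simpa using this
  · have hl := dgG_tendsto.add (tendsto_pow_inv 0 4 four_ne_zero)
    simp only [add_zero] at hl
    have := nonneg_of_step (fun x hx => by
      have h1 := dgG_sub hx
      have h2 := dgH_lower hx
      linarith) hl hx
    linarith

/-- Large-`N` expansion to order `N⁻²`, with error `O(N⁻⁴)`, of the bulk-scaled structure
function of the circular β-ensemble with β = 1 in the regime `0 < τ < 1`. -/
theorem coe_structure_function_expansion_small_tau (τ : ℝ) (hτ0 : 0 < τ) (hτ1 : τ < 1) :
    ∃ C > (0 : ℝ), ∃ N₀ : ℕ, ∀ N : ℕ, N₀ ≤ N →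
      |(2 * τ - τ * (digamma (N * (τ + 1 / 2) + 1 / 2) - digamma ((N + 1) / 2)))
          - (2 * τ - τ * Real.log (1 + 2 * τ) +
              (τ / (6 * N ^ 2)) * (1 - 1 / (1 + 2 * τ) ^ 2))|
        ≤ C / N ^ 4 := by
  refine ⟨16, by norm_num, 1, fun N hN => ?_⟩
  have hN' : (0 : ℝ) < N := by exact_mod_cast hN
  generalize (N : ℝ) = n at hN'
  have hy : 0 < n / 2 := by positivity
  have hx : 0 < n * (τ + 1 / 2) := by positivity
  obtain ⟨a1, a2⟩ := dgG_bounds hy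
  obtain ⟨b1, b2⟩ := dgG_bounds hx
  have hxy : ((n * (τ + 1 / 2)) ^ 4)⁻¹ ≤ ((n / 2) ^ 4)⁻¹ := by
    apply inv_anti₀ (by positivity)
    apply pow_le_pow_left₀ hy.le
    nlinarith
  have h16 : ((n / 2) ^ 4)⁻¹ = 16 / n ^ 4 := by
    field_simp
    norm_num
  have hlog : Real.log (n * (τ + 1 / 2)) = Real.log (1 + 2 * τ) + Real.log (n / 2) := by
    rw [← Real.log_mul (by positivity) (by positivity)]
    congr 1; ring
  have key : (2 * τ - τ * (digamma (n * (τ + 1 / 2) + 1 / 2) - digamma ((n + 1) / 2)))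
          - (2 * τ - τ * Real.log (1 + 2 * τ) +
              (τ / (6 * n ^ 2)) * (1 - 1 / (1 + 2 * τ) ^ 2))
      = τ * (dgG (n / 2) - dgG (n * (τ + 1 / 2))) := by
    simp only [dgG]
    rw [hlog, show (n + 1) / 2 = n / 2 + 1 / 2 by ring,
      show n * (τ + 1 / 2) = n * (1 + 2 * τ) / 2 by ring]
    have : 1 + 2 * τ ≠ 0 := by positivity
    field_simp
    ring
  rw [key, abs_mul, abs_of_pos hτ0]
  have hab : |dgG (n / 2) - dgG (n * (τ + 1 / 2))| ≤ 16 / n ^ 4 := by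
    rw [abs_le]; constructor <;> linarith
  calc _ ≤ 1 * |dgG (n / 2) - dgG (n * (τ + 1 / 2))| := by gcongr
    _ ≤ _ := by linarith
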